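/- (Erdős) The lower limit of the normalized prime gaps is strictly less than 1: liminf_{n→∞} (p_{n+1} − p_n)/log p_n < 1. -/

import Mathlib

open Real Filter

/-- `nthPrime n` is the `n`-th prime number `p_n` (so `p_1 = 2`, `p_2 = 3`, ...). -/
noncomputable def nthPrime (n : ℕ) : ℕ := Nat.nth Nat.Prime (n - 1)


lemma er_logfac (n : ℕ) : ∑ m ∈ Finset.Ioc 0 n, Chebyshev.psi ((n / m : ℕ) : ℝ) = Real.log (n.factorial) := by
  have h2 : ∑ k ∈ Finset.Ioc 0 n, ArithmeticFunction.log k = Real.log (n.factorial) := by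
    induction n with
    | zero => simp
    | succ n ih =>
      rw [Finset.sum_Ioc_succ_top (by omega), ih, Nat.factorial_succ]
      rw [ArithmeticFunction.log_apply]; push_cast
      rw [Real.log_mul (by positivity) (by positivity)]; ring
  have h1 := ArithmeticFunction.sum_Ioc_mul_eq_sum_sum (ArithmeticFunction.zeta : ArithmeticFunction ℝ) ArithmeticFunction.vonMangoldt n
  rw [ArithmeticFunction.zeta_mul_vonMangoldt] at h1
  rw [← h2, h1]
  apply Finset.sum_congr rfl
  intro m hm
  have : m ≠ 0 := by simp at hm; omega
  simp [Chebyshev.psi, this]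

lemma er_harm (n : ℕ) : ∑ m ∈ Finset.Ioc 0 n, (1:ℝ) / m ≤ 1 + Real.log n := by
  have := harmonic_le_one_add_log n
  rw [harmonic_eq_sum_Icc] at this
  push_cast at this
  simpa [← Finset.Icc_add_one_left_eq_Ioc] using this

lemma er_harm' (n : ℕ) : Real.log (n+1) ≤ ∑ m ∈ Finset.Ioc 0 n, (1:ℝ) / m := by
  have := log_add_one_le_harmonic n
  rw [harmonic_eq_sum_Icc] at this
  push_cast at this
  simpa [← Finset.Icc_add_one_left_eq_Ioc] using this

lemma er_no_theta (δ C : ℝ) (hδ : 0 < δ) (hδ1 : δ < 1)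
    (H : ∀ n : ℕ, Chebyshev.theta n ≤ (1 - δ) * n + C) : False := by
  obtain ⟨D, hD⟩ := Chebyshev.psi_sub_theta_le_mul_sqrt
  set C' := C + D^2/(2*δ) with hC'
  have hpsi : ∀ n : ℕ, Chebyshev.psi n ≤ (1 - δ/2) * n + C' := by
    intro n
    have h1 := hD n
    have h2 := H n
    have h3 : D * √(n:ℝ) ≤ δ/2 * n + D^2/(2*δ) := by
      have : (n:ℝ) = √(n:ℝ)^2 := (Real.sq_sqrt (by positivity)).symm
      have h4 : δ/2 * n + D^2/(2*δ) - D * √(n:ℝ) = (δ * √(n:ℝ) - D)^2/(2*δ) := by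
        nth_rw 1 [this]; field_simp; ring
      have : 0 ≤ (δ * √(n:ℝ) - D)^2/(2*δ) := by positivity
      linarith
    rw [hC']; nlinarith
  have key : ∀ n : ℕ, 1 ≤ n → (δ/2) * Real.log n ≤ 2 + |C'| := by
    intro n hn
    have hn0 : (0:ℝ) < n := by exact_mod_cast hn
    have h1 := er_logfac n
    have h2 := Stirling.le_log_factorial_stirling (n := n) (by omega)
    have h3 : ∑ m ∈ Finset.Ioc 0 n, Chebyshev.psi ((n / m : ℕ) : ℝ) ≤ ∑ m ∈ Finset.Ioc 0 n, ((1 - δ/2) * n * (1 / m) + |C'|) := by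
      apply Finset.sum_le_sum
      intro m hm
      have h4 := hpsi (n/m)
      have h5 : ((n / m : ℕ) : ℝ) ≤ n * (1/m) := by
        rw [mul_one_div]; exact Nat.cast_div_le
      have := le_abs_self C'
      nlinarith
    rw [Finset.sum_add_distrib, ← Finset.mul_sum] at h3
    have h6 := er_harm n
    simp only [Finset.sum_const, Nat.card_Ioc, tsub_zero, nsmul_eq_mul] at h3
    have h7 : (1 - δ/2) * n * ∑ m ∈ Finset.Ioc 0 n, (1:ℝ) / m ≤ (1 - δ/2) * n * (1 + Real.log n) := by
      apply mul_le_mul_of_nonneg_left h6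
      have : 0 < 1 - δ/2 := by linarith
      positivity
    have h8 : 0 ≤ Real.log n := Real.log_nonneg (by exact_mod_cast hn)
    have h9 : 0 ≤ Real.log (2 * π) := Real.log_nonneg (by have := Real.pi_gt_three; linarith)
    have h10 : n * ((δ/2) * Real.log n) ≤ n * (2 + |C'|) := by nlinarith
    exact le_of_mul_le_mul_left h10 hn0
  have ht : Tendsto (fun n : ℕ => (δ/2) * Real.log n) atTop atTop :=
    (Real.tendsto_log_atTop.comp tendsto_natCast_atTop_atTop).const_mul_atTop (by positivity)
  obtain ⟨n, h1, h2⟩ := ((ht.eventually_gt_atTop (2 + |C'|)).and (eventually_ge_atTop 1)).exists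
  exact absurd (key n h2) (not_le.mpr h1)

noncomputable def erS (s : BoundingSieve) (z : ℕ) : ℝ :=
  ∑ l ∈ s.prodPrimes.divisors with l ≤ z, s.selbergTerms l

noncomputable def erT (s : BoundingSieve) (z : ℕ) (l : ℕ) : ℝ :=
  if l ≤ z then (ArithmeticFunction.moebius l : ℝ) * s.selbergTerms l / erS s z else 0

noncomputable def erW (s : BoundingSieve) (z : ℕ) (d : ℕ) : ℝ :=
  if d ∣ s.prodPrimes then (s.nu d)⁻¹ * ∑ l ∈ s.prodPrimes.divisors,
    if d ∣ l then (ArithmeticFunction.moebius (l / d) : ℝ) * erT s z l else 0 else 0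

lemma erS_pos (s : BoundingSieve) (z : ℕ) (hz : 1 ≤ z) : 0 < erS s z := by
  unfold erS
  apply Finset.sum_pos
  · intro l hl
    simp at hl
    exact BoundingSieve.selbergTerms_pos hl.1.1
  · exact ⟨1, by simp [hz, BoundingSieve.prodPrimes_ne_zero]⟩

lemma er_mu_abs (n : ℕ) : |(ArithmeticFunction.moebius n : ℝ)| ≤ 1 := by
  exact_mod_cast ArithmeticFunction.abs_moebius_le_one (n := n)

lemma er_sumT (s : BoundingSieve) (z : ℕ) (hz : 1 ≤ z) :
    ∑ l ∈ s.prodPrimes.divisors, |erT s z l| ≤ 1 := by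
  have hS := erS_pos s z hz
  have : ∑ l ∈ s.prodPrimes.divisors, |erT s z l| ≤
      ∑ l ∈ s.prodPrimes.divisors, (if l ≤ z then s.selbergTerms l / erS s z else 0) := by
    apply Finset.sum_le_sum
    intro l hl
    unfold erT
    split_ifs with h
    · rw [abs_div, abs_mul, abs_of_pos hS]
      have h1 := er_mu_abs l
      have h2 : 0 < s.selbergTerms l := BoundingSieve.selbergTerms_pos (Nat.dvd_of_mem_divisors hl)
      rw [abs_of_pos h2]
      gcongr
      nlinarith
    · simp
  refine this.trans ?_
  rw [← Finset.sum_filter, ← Finset.sum_div]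
  exact le_of_eq (div_self hS.ne')

lemma erW_one (s : BoundingSieve) (z : ℕ) (hz : 1 ≤ z) : erW s z 1 = 1 := by
  have hS := erS_pos s z hz
  unfold erW
  simp only [one_dvd, if_true, Nat.div_one, s.nu_mult.map_one, inv_one, one_mul]
  have : ∀ l ∈ s.prodPrimes.divisors, (ArithmeticFunction.moebius l : ℝ) * erT s z l
      = if l ≤ z then s.selbergTerms l / erS s z else 0 := by
    intro l hl
    unfold erT
    split_ifs with h
    · have h1 : (ArithmeticFunction.moebius l : ℝ) * ArithmeticFunction.moebius l = 1 := by
        have := ArithmeticFunction.moebius_sq_eq_one_of_squarefree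
          (BoundingSieve.squarefree_of_mem_divisors_prodPrimes hl)
        rw [← sq]; exact_mod_cast this
      rw [mul_div_assoc, ← mul_assoc, h1, one_mul]
    · simp
  rw [Finset.sum_congr rfl this, ← Finset.sum_filter, ← Finset.sum_div]
  exact div_self hS.ne'

lemma er_nu_le_aux (s : BoundingSieve) {d : ℕ} (hd : d ∣ s.prodPrimes) : 0 < (s.nu d)⁻¹ :=
  inv_pos.mpr (BoundingSieve.nu_pos_of_dvd_prodPrimes hd)

lemma erW_abs (s : BoundingSieve) (z : ℕ) (hz : 1 ≤ z) (hν : ∀ d, d ∣ s.prodPrimes → (s.nu d)⁻¹ ≤ d)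
    (d : ℕ) : |erW s z d| ≤ d := by
  unfold erW
  split_ifs with hd
  · have h0 := er_nu_le_aux s hd
    rw [abs_mul, abs_of_pos h0]
    have : |∑ l ∈ s.prodPrimes.divisors,
      if d ∣ l then (ArithmeticFunction.moebius (l / d) : ℝ) * erT s z l else 0| ≤ 1 := by
      refine (Finset.abs_sum_le_sum_abs _ _).trans (le_trans ?_ (er_sumT s z hz))
      apply Finset.sum_le_sum
      intro l hl
      split_ifs
      · rw [abs_mul]
        have := er_mu_abs (l / d)
        have := abs_nonneg (erT s z l)
        nlinarith
      · simp
    have := hν d hd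
    nlinarith
  · simp

lemma erW_zero (s : BoundingSieve) (z : ℕ) (d : ℕ) (hdz : z < d) : erW s z d = 0 := by
  unfold erW
  split_ifs with hd
  · rw [Finset.sum_eq_zero, mul_zero]
    intro l hl
    split_ifs with h
    · have : d ≤ l := Nat.le_of_dvd (Nat.pos_of_mem_divisors hl) h
      unfold erT
      rw [if_neg (by omega), mul_zero]
    · rfl
  · rfl

lemma er_moebius_sum (P l m : ℕ) (hP : P ≠ 0) (hl : l ∣ P) (hm : m ∣ P) :
    ∑ d ∈ P.divisors, (if l ∣ d then if d ∣ m then (ArithmeticFunction.moebius (m / d) : ℝ) else 0 else 0)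
      = if m = l then 1 else 0 := by
  have hm0 : m ≠ 0 := fun h => hP (by simpa [h] using hm)
  have hl0 : l ≠ 0 := fun h => hP (by simpa [h] using hl)
  by_cases hlm : l ∣ m
  · obtain ⟨k, rfl⟩ := hlm
    have hk0 : k ≠ 0 := fun h => hm0 (by simp [h])
    have h1 : ∑ d ∈ P.divisors, (if l ∣ d then if d ∣ l * k then (ArithmeticFunction.moebius (l * k / d) : ℝ) else 0 else 0)
        = ∑ e ∈ k.divisors, (ArithmeticFunction.moebius (k / e) : ℝ) := by
      rw [← Finset.sum_filter, ← Finset.sum_filter]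
      symm
      apply Finset.sum_bij (fun e _ => l * e)
      · intro e he
        have he := Nat.dvd_of_mem_divisors he
        simp only [Finset.mem_filter, Nat.mem_divisors]
        exact ⟨⟨⟨(Nat.mul_dvd_mul_left l he).trans hm, hP⟩, Dvd.intro _ rfl⟩, Nat.mul_dvd_mul_left l he⟩
      · intro a _ b _ h
        exact Nat.eq_of_mul_eq_mul_left (Nat.pos_of_ne_zero hl0) h
      · intro d hd
        simp only [Finset.mem_filter, Nat.mem_divisors] at hd
        obtain ⟨⟨_, e, rfl⟩, h⟩ := hd
        exact ⟨e, by simpa [hk0] using Nat.dvd_of_mul_dvd_mul_left (Nat.pos_of_ne_zero hl0) h, rfl⟩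
      · intro e he
        rw [Nat.mul_div_mul_left _ _ (Nat.pos_of_ne_zero hl0)]
    rw [h1, Nat.sum_div_divisors k (fun e => (ArithmeticFunction.moebius e : ℝ))]
    have h2 : ∑ e ∈ k.divisors, ArithmeticFunction.moebius e = if k = 1 then 1 else 0 := by
      rw [← ArithmeticFunction.coe_zeta_mul_apply, ArithmeticFunction.coe_zeta_mul_moebius,
        ArithmeticFunction.one_apply]
    have h3 : (∑ e ∈ k.divisors, (ArithmeticFunction.moebius e : ℝ)) = if k = 1 then 1 else 0 := by
      exact_mod_cast h2
    rw [h3]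
    have : l * k = l ↔ k = 1 := by
      constructor
      · intro h; exact Nat.eq_of_mul_eq_mul_left (Nat.pos_of_ne_zero hl0) (by simpa using h)
      · rintro rfl; simp
    simp only [this]
  · rw [if_neg (by rintro rfl; exact hlm dvd_rfl)]
    apply Finset.sum_eq_zero
    intro d _
    split_ifs with h1 h2
    · exact absurd (h1.trans h2) hlm
    · rfl
    · rfl

lemma erV (s : BoundingSieve) (z l : ℕ) (hl : l ∣ s.prodPrimes) :
    ∑ d ∈ s.prodPrimes.divisors, (if l ∣ d then s.nu d * erW s z d else 0) = erT s z l := by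
  have h1 : ∀ d ∈ s.prodPrimes.divisors, (if l ∣ d then s.nu d * erW s z d else 0) =
      ∑ m ∈ s.prodPrimes.divisors, (if l ∣ d then if d ∣ m then (ArithmeticFunction.moebius (m / d) : ℝ) else 0 else 0) * erT s z m := by
    intro d hd
    have hd := Nat.dvd_of_mem_divisors hd
    split_ifs with h
    · unfold erW
      rw [if_pos hd, ← mul_assoc, mul_inv_cancel₀ (BoundingSieve.nu_ne_zero hd), one_mul]
      apply Finset.sum_congr rfl
      intro m _
      split_ifs <;> simp
    · simp
  rw [Finset.sum_congr rfl h1, Finset.sum_comm]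
  simp_rw [← Finset.sum_mul]
  rw [Finset.sum_eq_single_of_mem l (by simp [hl, BoundingSieve.prodPrimes_ne_zero])]
  · rw [er_moebius_sum _ _ _ BoundingSieve.prodPrimes_ne_zero hl hl]; simp
  · intro m hm hml
    rw [er_moebius_sum _ _ _ BoundingSieve.prodPrimes_ne_zero hl (Nat.dvd_of_mem_divisors hm)]; simp [hml]

lemma er_main (s : BoundingSieve) (z : ℕ) (hz : 1 ≤ z) :
    s.mainSum (BoundingSieve.lambdaSquared (erW s z)) = 1 / erS s z := by
  have hS := erS_pos s z hz
  rw [BoundingSieve.mainSum_lambdaSquared_eq_sum_mul_sum_sq]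
  have : ∀ l ∈ s.prodPrimes.divisors, (s.selbergTerms l)⁻¹ *
        (∑ d ∈ s.prodPrimes.divisors, if l ∣ d then s.nu d * erW s z d else 0) ^ 2
      = if l ≤ z then s.selbergTerms l / erS s z ^ 2 else 0 := by
    intro l hl
    rw [erV s z l (Nat.dvd_of_mem_divisors hl)]
    have h2 : 0 < s.selbergTerms l := BoundingSieve.selbergTerms_pos (Nat.dvd_of_mem_divisors hl)
    unfold erT
    split_ifs with h
    · have h1 : (ArithmeticFunction.moebius l : ℝ) ^ 2 = 1 := by
        have := ArithmeticFunction.moebius_sq_eq_one_of_squarefree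
          (BoundingSieve.squarefree_of_mem_divisors_prodPrimes hl)
        exact_mod_cast this
      rw [div_pow, mul_pow, h1]; field_simp
    · simp
  rw [Finset.sum_congr rfl this, ← Finset.sum_filter, ← Finset.sum_div]
  change erS s z / _ = _
  field_simp

lemma er_err (s : BoundingSieve) (z : ℕ) (hz : 1 ≤ z) (hν : ∀ d, d ∣ s.prodPrimes → (s.nu d)⁻¹ ≤ d)
    (hrem : ∀ d, d ∣ s.prodPrimes → |s.rem d| ≤ d) :
    s.errSum (BoundingSieve.lambdaSquared (erW s z)) ≤ (z : ℝ) ^ 8 := by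
  have hz1 : (1:ℝ) ≤ z := by exact_mod_cast hz
  have hW : ∀ d, |erW s z d| ≤ z := by
    intro d
    by_cases h : z < d
    · rw [erW_zero s z d h]; simp
    · exact (erW_abs s z hz hν d).trans (by exact_mod_cast not_lt.mp h)
  have hL0 : ∀ d, z ^ 2 < d → BoundingSieve.lambdaSquared (erW s z) d = 0 := by
    intro d hd
    unfold BoundingSieve.lambdaSquared
    apply Finset.sum_eq_zero
    intro d1 _
    apply Finset.sum_eq_zero
    intro d2 _
    split_ifs with h
    · by_cases h1 : z < d1
      · rw [erW_zero _ _ _ h1, zero_mul]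
      · by_cases h2 : z < d2
        · rw [erW_zero _ _ _ h2, mul_zero]
        · exfalso
          have h3 : d1.lcm d2 ≤ d1 * d2 := by
            by_cases hp : d1 * d2 = 0
            · rcases Nat.mul_eq_zero.mp hp with h | h <;> simp [h]
            · exact Nat.le_of_dvd (Nat.pos_of_ne_zero hp) (Nat.lcm_dvd_mul _ _)
          have : d1 * d2 ≤ z * z := Nat.mul_le_mul (by omega) (by omega)
          nlinarith
    · rfl
  have hsum : ∀ d : ℕ, ∑ d1 ∈ d.divisors, |erW s z d1| ≤ (z:ℝ) ^ 2 := by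
    intro d
    calc ∑ d1 ∈ d.divisors, |erW s z d1| ≤ ∑ d1 ∈ d.divisors, (if d1 ≤ z then (z:ℝ) else 0) := by
          apply Finset.sum_le_sum
          intro d1 _
          split_ifs with h
          · exact hW d1
          · rw [erW_zero _ _ _ (by omega)]; simp
      _ = ∑ d1 ∈ d.divisors with d1 ≤ z, (z:ℝ) := by rw [Finset.sum_filter]
      _ ≤ ∑ d1 ∈ Finset.Ioc 0 z, (z:ℝ) := by
          apply Finset.sum_le_sum_of_subset_of_nonneg
          · intro d1 h
            simp only [Finset.mem_filter] at h
            simp [Nat.pos_of_mem_divisors h.1, h.2]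
          · intros; positivity
      _ = (z:ℝ)^2 := by simp; ring
  have hL : ∀ d, |BoundingSieve.lambdaSquared (erW s z) d| ≤ (z:ℝ)^4 := by
    intro d
    unfold BoundingSieve.lambdaSquared
    calc _ ≤ ∑ d1 ∈ d.divisors, ∑ d2 ∈ d.divisors, |erW s z d1| * |erW s z d2| := by
          refine (Finset.abs_sum_le_sum_abs _ _).trans (Finset.sum_le_sum fun d1 _ => ?_)
          refine (Finset.abs_sum_le_sum_abs _ _).trans (Finset.sum_le_sum fun d2 _ => ?_)
          split_ifs
          · rw [abs_mul]
          · simp; positivity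
      _ = (∑ d1 ∈ d.divisors, |erW s z d1|) * (∑ d1 ∈ d.divisors, |erW s z d1|) := by
          rw [Finset.sum_mul_sum]
      _ ≤ (z:ℝ)^2 * (z:ℝ)^2 := by
          have h0 : 0 ≤ ∑ d1 ∈ d.divisors, |erW s z d1| := Finset.sum_nonneg fun _ _ => abs_nonneg _
          exact mul_le_mul (hsum d) (hsum d) h0 (by positivity)
      _ = _ := by ring
  unfold BoundingSieve.errSum
  calc _ ≤ ∑ d ∈ s.prodPrimes.divisors, (if d ≤ z^2 then (z:ℝ)^4 * (z:ℝ)^2 else 0) := by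
        apply Finset.sum_le_sum
        intro d hd
        split_ifs with h
        · have h1 := hrem d (Nat.dvd_of_mem_divisors hd)
          have h2 : (d:ℝ) ≤ (z:ℝ)^2 := by exact_mod_cast h
          exact mul_le_mul (hL d) (h1.trans h2) (abs_nonneg _) (by positivity)
        · rw [hL0 d (by omega)]; simp
    _ = ∑ d ∈ s.prodPrimes.divisors with d ≤ z^2, (z:ℝ)^4 * (z:ℝ)^2 := by rw [Finset.sum_filter]
    _ ≤ ∑ d ∈ Finset.Ioc 0 (z^2), (z:ℝ)^4 * (z:ℝ)^2 := by
        apply Finset.sum_le_sum_of_subset_of_nonneg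
        · intro d1 h
          simp only [Finset.mem_filter] at h
          simp only [Finset.mem_Ioc]
          exact ⟨Nat.pos_of_mem_divisors h.1, h.2⟩
        · intros; positivity
    _ = (z:ℝ)^8 := by simp; ring

lemma er_selberg (s : BoundingSieve) (z : ℕ) (hz : 1 ≤ z) (hν : ∀ d, d ∣ s.prodPrimes → (s.nu d)⁻¹ ≤ d)
    (hrem : ∀ d, d ∣ s.prodPrimes → |s.rem d| ≤ d) :
    s.siftedSum ≤ s.totalMass / erS s z + (z : ℝ) ^ 8 := by
  have h1 := BoundingSieve.siftedSum_le_mainSum_errSum_of_upperMoebius (s := s) _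
    (BoundingSieve.upperMoebius_lambdaSquared (erW s z) (erW_one s z hz))
  rw [er_main s z hz, mul_one_div] at h1
  linarith [er_err s z hz hν hrem]

def erRho (h d : ℕ) : ℕ := ((Finset.range d).filter (fun r => d ∣ r * (r + h))).card

lemma erRho_mul (h a b : ℕ) (hab : a.Coprime b) : erRho h (a * b) = erRho h a * erRho h b := by
  unfold erRho
  rw [← Finset.card_product]
  rcases Nat.eq_zero_or_pos a with rfl | ha
  · simp
  rcases Nat.eq_zero_or_pos b with rfl | hb
  · simp
  have hmod : ∀ c r : ℕ, c ∣ (r % c) * (r % c + h) ↔ c ∣ r * (r + h) := by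
    intro c r
    apply Nat.ModEq.dvd_iff _ dvd_rfl
    exact (Nat.mod_modEq r c).mul ((Nat.mod_modEq r c).add_right h)
  apply Finset.card_bij (fun r _ => (r % a, r % b))
  · intro r hr
    simp only [Finset.mem_filter, Finset.mem_range, Finset.mem_product] at hr ⊢
    rw [hmod, hmod]
    exact ⟨⟨Nat.mod_lt _ ha, (Dvd.intro _ rfl).trans hr.2⟩, ⟨Nat.mod_lt _ hb, (Dvd.intro_left _ rfl).trans hr.2⟩⟩
  · intro r hr r' hr' h
    simp only [Finset.mem_filter, Finset.mem_range, Prod.mk.injEq] at hr hr' h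
    have h1 : r ≡ r' [MOD a * b] := (Nat.modEq_and_modEq_iff_modEq_mul hab).mp ⟨h.1, h.2⟩
    exact Nat.ModEq.eq_of_lt_of_lt h1 hr.1 hr'.1
  · rintro ⟨u, v⟩ huv
    simp only [Finset.mem_filter, Finset.mem_range, Finset.mem_product] at huv
    obtain ⟨⟨hu, hu2⟩, hv, hv2⟩ := huv
    obtain ⟨k, hk1, hk2⟩ := Nat.chineseRemainder hab u v
    have e1 : k % (a*b) % a = u := by
      rw [Nat.mod_mul_right_mod]; rw [Nat.ModEq, Nat.mod_eq_of_lt hu] at hk1; exact hk1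
    have e2 : k % (a*b) % b = v := by
      rw [Nat.mod_mul_left_mod]; rw [Nat.ModEq, Nat.mod_eq_of_lt hv] at hk2; exact hk2
    refine ⟨k % (a * b), ?_, ?_⟩
    · simp only [Finset.mem_filter, Finset.mem_range]
      refine ⟨Nat.mod_lt _ (Nat.mul_pos ha hb), ?_⟩
      apply hab.mul_dvd_of_dvd_of_dvd
      · rw [← hmod, e1]; exact hu2
      · rw [← hmod, e2]; exact hv2
    · simp only [e1, e2]

lemma erRho_one (h : ℕ) : erRho h 1 = 1 := by
  simp [erRho]

lemma erRho_pos (h d : ℕ) (hd : 0 < d) : 1 ≤ erRho h d := by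
  unfold erRho
  rw [Nat.one_le_iff_ne_zero, ← Nat.pos_iff_ne_zero, Finset.card_pos]
  exact ⟨0, by simp [hd]⟩

lemma erRho_le (h d : ℕ) : erRho h d ≤ d := by
  unfold erRho
  exact (Finset.card_filter_le _ _).trans (by simp)

lemma erRho_lt (h p : ℕ) (hh : Even h) (hp : p.Prime) : erRho h p < p := by
  unfold erRho
  have key : ∃ r, r < p ∧ ¬ p ∣ r * (r + h) := by
    by_cases h1 : p ∣ 1 + h
    · have hp2 : p ≠ 2 := by
        rintro rfl
        rw [even_iff_two_dvd] at hh; omega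
      have := hp.two_le
      refine ⟨2, by omega, ?_⟩
      rw [hp.dvd_mul]
      rintro (h2 | h2)
      · have := Nat.le_of_dvd (by omega) h2; omega
      · have h3 : p ∣ 1 := by
          have := Nat.dvd_sub h2 h1
          have e : 2 + h - (1 + h) = 1 := by omega
          rwa [e] at this
        have := Nat.le_of_dvd (by omega) h3; omega
    · exact ⟨1, hp.one_lt, by simpa using h1⟩
  obtain ⟨r, hr, hr2⟩ := key
  calc _ < (Finset.range p).card := by
        apply Finset.card_lt_card
        rw [Finset.filter_ssubset]
        exact ⟨r, by simpa using hr, hr2⟩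
    _ = p := by simp

lemma erRho_two (h p : ℕ) (hp : p.Prime) (hph : ¬ p ∣ h) : 2 ≤ erRho h p := by
  unfold erRho
  have h0 : 0 < h % p := Nat.pos_of_ne_zero fun h => hph (Nat.dvd_of_mod_eq_zero h)
  have h1 : h % p < p := Nat.mod_lt _ hp.pos
  have : ({0, p - h % p} : Finset ℕ) ⊆ (Finset.range p).filter (fun r => p ∣ r * (r + h)) := by
    intro r hr
    simp only [Finset.mem_insert, Finset.mem_singleton] at hr
    simp only [Finset.mem_filter, Finset.mem_range]
    rcases hr with rfl | rfl
    · simp [hp.pos]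
    · refine ⟨by omega, Dvd.dvd.mul_left ?_ _⟩
      have e : p - h % p + h = p * (1 + h / p) := by
        have := Nat.mod_add_div h p
        rw [mul_add]; omega
      rw [e]; exact Dvd.intro _ rfl
  calc 2 = ({0, p - h % p} : Finset ℕ).card := by
        rw [Finset.card_pair]; omega
    _ ≤ _ := Finset.card_le_card this

lemma er_count (h d N : ℕ) (hd : 0 < d) :
    |(((Finset.Ico 1 (1 + N)).filter (fun r => d ∣ r * (r + h))).card : ℝ) - (erRho h d : ℝ) / d * N| ≤ d := by
  have hper : Function.Periodic (fun r => d ∣ r * (r + h)) d := by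
    intro r
    apply propext
    apply Nat.ModEq.dvd_iff _ dvd_rfl
    have : r + d ≡ r [MOD d] := by simp [Nat.ModEq]
    exact this.mul (this.add_right h)
  have hd' : (0:ℝ) < d := by exact_mod_cast hd
  have hρ : (erRho h d : ℝ) / d ≤ 1 := by
    rw [div_le_one hd']; exact_mod_cast erRho_le h d
  have hρ0 : 0 ≤ (erRho h d : ℝ) / d := by positivity
  induction N using Nat.strong_induction_on with
  | _ N ih =>
    by_cases hN : N < d
    · have h1 : (((Finset.Ico 1 (1 + N)).filter (fun r => d ∣ r * (r + h))).card : ℝ) ≤ N := by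
        exact_mod_cast (Finset.card_filter_le _ _).trans (by simp)
      have h2 : (N:ℝ) ≤ d := by exact_mod_cast hN.le
      have h3 : (0:ℝ) ≤ N := by positivity
      have h4 : (0:ℝ) ≤ (((Finset.Ico 1 (1 + N)).filter (fun r => d ∣ r * (r + h))).card : ℝ) := by positivity
      rw [abs_le]
      constructor <;> nlinarith
    · obtain ⟨M, rfl⟩ : ∃ M, N = M + d := ⟨N - d, by omega⟩
      have h1 := ih M (by omega)
      have h2 : ((Finset.Ico 1 (1 + (M + d))).filter (fun r => d ∣ r * (r + h))).card
          = ((Finset.Ico 1 (1 + M)).filter (fun r => d ∣ r * (r + h))).card + erRho h d := by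
        rw [← Finset.Ico_union_Ico_eq_Ico (show 1 ≤ 1 + M by omega) (show 1 + M ≤ 1 + (M + d) by omega),
          Finset.filter_union, Finset.card_union_of_disjoint]
        · congr 1
          rw [← add_assoc, Nat.filter_Ico_card_eq_of_periodic (1+M) d _ hper, Nat.count_eq_card_filter_range]
          rfl
        · apply Finset.disjoint_filter_filter
          exact Finset.Ico_disjoint_Ico_consecutive _ _ _
      rw [h2]
      push_cast
      have e : (((Finset.Ico 1 (1 + M)).filter (fun r => d ∣ r * (r + h))).card : ℝ) + erRho h d - (erRho h d : ℝ) / d * (M + d)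
        = (((Finset.Ico 1 (1 + M)).filter (fun r => d ∣ r * (r + h))).card : ℝ) - (erRho h d : ℝ) / d * M := by
        field_simp; ring
      rw [e]; exact h1

noncomputable def erNu (h : ℕ) : ArithmeticFunction ℝ := ⟨fun d => (erRho h d : ℝ) / d, by simp⟩

lemma erNu_apply (h d : ℕ) : erNu h d = (erRho h d : ℝ) / d := rfl

lemma er_primorial_sqf (z : ℕ) : Squarefree (primorial z) := by
  unfold primorial
  apply Finset.squarefree_prod_of_pairwise_isCoprime
  · intro p hp q hq hpq
    simp only [Finset.coe_filter, Set.mem_ofPred_eq] at hp hq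
    exact Nat.coprime_iff_isRelPrime.mp <| (Nat.coprime_primes hp.2 hq.2).mpr hpq
  · intro p hp
    exact (Finset.mem_filter.mp hp).2.prime.squarefree

noncomputable def erSieve (h N z : ℕ) (hh : Even h) : BoundingSieve where
  support := (Finset.Ico 1 (1 + N)).image (fun n => n * (n + h))
  prodPrimes := primorial z
  prodPrimes_squarefree := er_primorial_sqf z
  weights := fun _ => 1
  weights_nonneg := fun _ => zero_le_one
  totalMass := N
  nu := erNu h
  nu_mult := by
    rw [ArithmeticFunction.IsMultiplicative.iff_ne_zero]
    refine ⟨by simp [erNu_apply, erRho_one], ?_⟩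
    intro m n _ _ hmn
    simp only [erNu_apply, erRho_mul h m n hmn]
    push_cast
    rw [mul_div_mul_comm]
  nu_pos_of_prime := by
    intro p hp _
    have := erRho_pos h p hp.pos
    have := hp.pos
    rw [erNu_apply]; positivity
  nu_lt_one_of_prime := by
    intro p hp _
    have h1 := erRho_lt h p hh hp
    have := hp.pos
    rw [erNu_apply, div_lt_one (by positivity)]
    exact_mod_cast h1

lemma er_inj (h : ℕ) : Function.Injective (fun n : ℕ => n * (n + h)) := by
  apply StrictMono.injective
  intro a b hab
  show a * (a + h) < b * (b + h)
  nlinarith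

lemma er_dvd_primorial {p z : ℕ} (hp : p.Prime) : p ∣ primorial z ↔ p ≤ z := by
  unfold primorial
  rw [Prime.dvd_finsetProd_iff hp.prime]
  constructor
  · rintro ⟨q, hq, hpq⟩
    simp only [Finset.mem_filter, Finset.mem_range] at hq
    rw [Nat.prime_dvd_prime_iff_eq hp hq.2] at hpq
    omega
  · intro h
    exact ⟨p, by simp [hp]; omega, dvd_rfl⟩

lemma er_pairs (h N z : ℕ) (hh : Even h) (hz : 1 ≤ z) :
    (((Finset.Ico 1 (1 + N)).filter (fun n => n.Prime ∧ (n + h).Prime)).card : ℝ) ≤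
      z + N / erS (erSieve h N z hh) z + (z:ℝ) ^ 8 := by
  have h1 := er_selberg (erSieve h N z hh) z hz ?_ ?_
  · have h2 : (erSieve h N z hh).siftedSum =
      (((Finset.Ico 1 (1 + N)).filter (fun n => (primorial z).Coprime (n * (n + h)))).card : ℝ) := by
      have e : (erSieve h N z hh).siftedSum = ∑ d ∈ (Finset.Ico 1 (1 + N)).image (fun n => n * (n + h)),
          if (primorial z).Coprime d then (1:ℝ) else 0 := rfl
      rw [e, Finset.sum_image (by intro a _ b _ hab; exact er_inj h hab)]
      simp
    have h3 : ((Finset.Ico 1 (1 + N)).filter (fun n => n.Prime ∧ (n + h).Prime)) ⊆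
        (Finset.Ico 1 (1 + z)) ∪ ((Finset.Ico 1 (1 + N)).filter (fun n => (primorial z).Coprime (n * (n + h)))) := by
      intro n hn
      simp only [Finset.mem_filter, Finset.mem_Ico, Finset.mem_union] at hn ⊢
      by_cases hnz : n ≤ z
      · left; omega
      · right
        refine ⟨hn.1, ?_⟩
        apply Nat.Coprime.symm
        apply Nat.Coprime.mul_left
        · rw [hn.2.1.coprime_iff_not_dvd, er_dvd_primorial hn.2.1]; exact hnz
        · rw [hn.2.2.coprime_iff_not_dvd, er_dvd_primorial hn.2.2]; omega
    have h4 := (Finset.card_le_card h3).trans (Finset.card_union_le _ _)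
    rw [h2] at h1
    have h5 : (((Finset.Ico 1 (1 + N)).filter (fun n => n.Prime ∧ (n + h).Prime)).card : ℝ) ≤
      z + (((Finset.Ico 1 (1 + N)).filter (fun n => (primorial z).Coprime (n * (n + h)))).card : ℝ) := by
      simp only [Nat.card_Ico, Nat.add_sub_cancel_left] at h4
      exact_mod_cast h4
    have h6 : (erSieve h N z hh).totalMass = N := rfl
    rw [h6] at h1
    linarith
  · intro d hd
    have hd0 : 0 < d := Nat.pos_of_dvd_of_pos hd (primorial_pos z)
    change (erNu h d)⁻¹ ≤ d
    rw [erNu_apply, inv_div]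
    apply div_le_self (by positivity)
    exact_mod_cast erRho_pos h d hd0
  · intro d hd
    have hd0 : 0 < d := Nat.pos_of_dvd_of_pos hd (primorial_pos z)
    have := er_count h d N hd0
    convert this using 2
    unfold BoundingSieve.rem BoundingSieve.multSum
    simp only [erSieve]
    rw [Finset.sum_image (by intro a _ b _ hab; exact er_inj h hab)]
    simp [erNu_apply]

noncomputable def erF (h : ℕ) : ℕ →* ℝ where
  toFun n := if n = 0 then 0 else n.factorization.prod (fun p k => erNu h p ^ k)
  map_one' := by simp
  map_mul' := by
    intro m n
    by_cases hm : m = 0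
    · simp [hm]
    by_cases hn : n = 0
    · simp [hn]
    simp only [hm, hn, mul_eq_zero, or_self, if_false]
    rw [Nat.factorization_mul hm hn, Finsupp.prod_add_index']
    · simp
    · intro p a b; exact pow_add _ _ _

lemma erF_apply (h n : ℕ) (hn : n ≠ 0) : erF h n = n.factorization.prod (fun p k => erNu h p ^ k) := by
  simp [erF, hn]

lemma erF_prime (h p : ℕ) (hp : p.Prime) : erF h p = erNu h p := by
  rw [erF_apply h p hp.ne_zero, hp.factorization]
  simp

lemma erNu_nonneg (h d : ℕ) : 0 ≤ erNu h d := by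
  rw [erNu_apply]; positivity

lemma erF_nonneg (h n : ℕ) : 0 ≤ erF h n := by
  by_cases hn : n = 0
  · simp [erF, hn]
  · rw [erF_apply h n hn]
    exact Finset.prod_nonneg fun p _ => pow_nonneg (erNu_nonneg h p) _

lemma erF_sqf (h N z l : ℕ) (hh : Even h) (hl : l ∣ primorial z) : erF h l = erNu h l := by
  have h1 := BoundingSieve.prod_primeFactors_nu (s := erSieve h N z hh) hl
  change _ = erNu h l at h1
  rw [← h1]
  have hsq : Squarefree l := (er_primorial_sqf z).squarefree_of_dvd hl
  have h2 := Nat.prod_primeFactors_of_squarefree hsq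
  conv_lhs => rw [← h2]
  rw [map_prod]
  apply Finset.prod_congr rfl
  intro p hp
  exact erF_prime h p (Nat.prime_of_mem_primeFactors hp)

lemma er_fiber (h N z l : ℕ) (hh : Even h) (hl : l ∣ primorial z) :
    ∑ n ∈ (Finset.Ioc 0 z).filter (fun n => ∏ p ∈ n.primeFactors, p = l), erF h n
      ≤ (erSieve h N z hh).selbergTerms l := by
  have hl0 : 0 < l := Nat.pos_of_dvd_of_pos hl (primorial_pos z)
  rw [BoundingSieve.selbergTerms_apply]
  change _ ≤ erNu h l * ∏ p ∈ l.primeFactors, (1 - erNu h p)⁻¹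
  have hH := (EulerProduct.summable_and_hasSum_factoredNumbers_prod_filter_prime_geometric (f := erF h) (by
    intro p hp
    rw [erF_prime h p hp, Real.norm_of_nonneg (erNu_nonneg h p), erNu_apply, div_lt_one (by exact_mod_cast hp.pos)]
    exact_mod_cast erRho_lt h p hh hp) l.primeFactors).2
  have e1 : ∏ p ∈ l.primeFactors with p.Prime, (1 - erF h p)⁻¹ = ∏ p ∈ l.primeFactors, (1 - erNu h p)⁻¹ := by
    rw [Finset.filter_true_of_mem (fun p hp => Nat.prime_of_mem_primeFactors hp)]
    apply Finset.prod_congr rfl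
    intro p hp
    rw [erF_prime h p (Nat.prime_of_mem_primeFactors hp)]
  rw [e1] at hH
  rw [← erF_sqf h N z l hh hl]
  set A := (Finset.Ioc 0 z).filter (fun n => ∏ p ∈ n.primeFactors, p = l) with hA
  have hAl : ∀ n ∈ A, l ∣ n ∧ 0 < n ∧ n.primeFactors = l.primeFactors := by
    intro n hn
    rw [hA, Finset.mem_filter, Finset.mem_Ioc] at hn
    refine ⟨hn.2 ▸ Nat.prod_primeFactors_dvd n, hn.1.1, ?_⟩
    rw [← hn.2, Nat.primeFactors_prod]
    intro p hp; exact Nat.prime_of_mem_primeFactors hp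
  have hmem : ∀ n ∈ A, n / l ∈ Nat.factoredNumbers l.primeFactors := by
    intro n hn
    obtain ⟨h1, h2, h3⟩ := hAl n hn
    rw [Nat.mem_factoredNumbers]
    refine ⟨(Nat.div_pos (Nat.le_of_dvd h2 h1) hl0).ne', ?_⟩
    intro p hp
    rw [← h3]
    have := Nat.dvd_of_mem_primeFactorsList hp
    rw [Nat.mem_primeFactors]
    exact ⟨Nat.prime_of_mem_primeFactorsList hp, this.trans (Nat.div_dvd_of_dvd h1), h2.ne'⟩
  have e2 : ∑ n ∈ A, erF h n = erF h l * ∑ n ∈ A.attach, erF h ((⟨n.1 / l, hmem n.1 n.2⟩ : Nat.factoredNumbers l.primeFactors) : ℕ) := by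
    rw [Finset.mul_sum, ← Finset.sum_attach]
    apply Finset.sum_congr rfl
    intro n _
    rw [← map_mul, Nat.mul_div_cancel' (hAl n.1 n.2).1]
  rw [e2]
  apply mul_le_mul_of_nonneg_left _ (erF_nonneg h l)
  have e3 : ∑ n ∈ A.attach, erF h ((⟨n.1 / l, hmem n.1 n.2⟩ : Nat.factoredNumbers l.primeFactors) : ℕ)
     = ∑ m ∈ A.attach.image (fun n => (⟨n.1 / l, hmem n.1 n.2⟩ : Nat.factoredNumbers l.primeFactors)), erF h (m:ℕ) := by
    rw [Finset.sum_image]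
    rintro ⟨a, ha⟩ _ ⟨b, hb⟩ _ hab
    simp only [Subtype.mk.injEq] at hab ⊢
    rw [← Nat.mul_div_cancel' (hAl a ha).1, ← Nat.mul_div_cancel' (hAl b hb).1, hab]
  rw [e3]
  exact sum_le_hasSum _ (fun _ _ => erF_nonneg h _) hH

lemma er_S_ge (h N z : ℕ) (hh : Even h) :
    ∑ n ∈ Finset.Ioc 0 z, erF h n ≤ erS (erSieve h N z hh) z := by
  unfold erS
  rw [← Finset.sum_fiberwise_of_maps_to (s := Finset.Ioc 0 z) (t := (erSieve h N z hh).prodPrimes.divisors.filter (· ≤ z)) (g := fun n => ∏ p ∈ n.primeFactors, p)]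
  · apply Finset.sum_le_sum
    intro l hl
    apply er_fiber
    exact Nat.dvd_of_mem_divisors (Finset.mem_filter.mp hl).1
  · intro n hn
    rw [Finset.mem_Ioc] at hn
    rw [Finset.mem_filter, Nat.mem_divisors]
    refine ⟨⟨?_, BoundingSieve.prodPrimes_ne_zero⟩, (Nat.le_of_dvd hn.1 (Nat.prod_primeFactors_dvd n)).trans hn.2⟩
    change _ ∣ primorial z
    apply Finset.prod_primes_dvd
    · intro p hp; exact (Nat.prime_of_mem_primeFactors hp).prime
    · intro p hp
      rw [er_dvd_primorial (Nat.prime_of_mem_primeFactors hp)]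
      exact (Nat.le_of_dvd hn.1 (Nat.dvd_of_mem_primeFactors hp)).trans hn.2

def erC (h n : ℕ) : ℕ := (n.divisors.filter (fun e => e.Coprime h)).card

lemma erC_le (h n : ℕ) (hn : n ≠ 0) : (erC h n : ℝ) ≤ n * erF h n := by
  induction n using induction_on_primes with
  | zero => exact absurd rfl hn
  | one => simp [erC, Finset.filter_singleton]
  | prime_mul p a hp ih =>
    have ha : a ≠ 0 := by rintro rfl; simp at hn
    have ih := ih ha
    rw [map_mul, erF_prime h p hp, erNu_apply]
    have hp0 : (0:ℝ) < p := by exact_mod_cast hp.pos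
    have e : ((p * a : ℕ) : ℝ) * ((erRho h p : ℝ) / p * erF h a) = erRho h p * (a * erF h a) := by
      push_cast; field_simp
    rw [e]
    have key : erC h (p * a) ≤ erRho h p * erC h a := by
      by_cases hph : p ∣ h
      · have h1 : erC h (p * a) ≤ erC h a := by
          apply Finset.card_le_card
          intro e he
          simp only [Finset.mem_filter, Nat.mem_divisors] at he ⊢
          refine ⟨⟨?_, ha⟩, he.2⟩
          have : e.Coprime p := he.2.coprime_dvd_right hph
          exact this.dvd_of_dvd_mul_left he.1.1
        have h2 := erRho_pos h p hp.pos
        nlinarith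
      · have h1 : erC h (p * a) ≤ erC h a + erC h a := by
          unfold erC
          calc _ ≤ ((a.divisors.filter (fun e => e.Coprime h)) ∪ (a.divisors.filter (fun e => e.Coprime h)).image (fun e => p * e)).card := by
                apply Finset.card_le_card
                intro e he
                simp only [Finset.mem_filter, Nat.mem_divisors, Finset.mem_union, Finset.mem_image] at he ⊢
                by_cases hpe : p ∣ e
                · right
                  obtain ⟨f, rfl⟩ := hpe
                  exact ⟨f, ⟨⟨Nat.dvd_of_mul_dvd_mul_left hp.pos he.1.1, ha⟩, he.2.coprime_mul_left⟩, rfl⟩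
                · left
                  have : e.Coprime p := ((hp.coprime_iff_not_dvd).mpr hpe).symm
                  exact ⟨⟨this.dvd_of_dvd_mul_left he.1.1, ha⟩, he.2⟩
            _ ≤ _ := (Finset.card_union_le _ _).trans (Nat.add_le_add_left Finset.card_image_le _)
        have h2 := erRho_two h p hp hph
        nlinarith
    have key' : (erC h (p*a) : ℝ) ≤ erRho h p * erC h a := by exact_mod_cast key
    have : (0:ℝ) ≤ erRho h p := by positivity
    nlinarith

lemma er_prod_ge (h y z : ℕ) (hyz : y * y ≤ z) :
    (∑ e ∈ (Finset.Ioc 0 y).filter (fun e => e.Coprime h), (1:ℝ) / e) * (∑ m ∈ Finset.Ioc 0 y, (1:ℝ) / m)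
      ≤ ∑ n ∈ Finset.Ioc 0 z, erF h n := by
  have h1 : ∑ n ∈ Finset.Ioc 0 z, (erC h n : ℝ) / n ≤ ∑ n ∈ Finset.Ioc 0 z, erF h n := by
    apply Finset.sum_le_sum
    intro n hn
    rw [Finset.mem_Ioc] at hn
    have : (0:ℝ) < n := by exact_mod_cast hn.1
    rw [div_le_iff₀ this, mul_comm]
    exact erC_le h n (by omega)
  refine le_trans ?_ h1
  have h2 : ∑ n ∈ Finset.Ioc 0 z, (erC h n : ℝ) / n =
     ∑ x ∈ (Finset.Ioc 0 z).sigma (fun n => n.divisors.filter (fun e => e.Coprime h)), (1:ℝ) / x.1 := by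
    rw [Finset.sum_sigma]
    apply Finset.sum_congr rfl
    intro n _
    simp [erC, div_eq_mul_inv]
  rw [h2, Finset.sum_mul_sum, ← Finset.sum_product']
  have h3 : ∑ x ∈ ((Finset.Ioc 0 y).filter (fun e => e.Coprime h)) ×ˢ Finset.Ioc 0 y, (1:ℝ) / x.1 * (1 / x.2)
      = ∑ x ∈ (((Finset.Ioc 0 y).filter (fun e => e.Coprime h)) ×ˢ Finset.Ioc 0 y).image
          (fun x : ℕ × ℕ => (⟨x.1 * x.2, x.1⟩ : Σ _ : ℕ, ℕ)), (1:ℝ) / x.1 := by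
    rw [Finset.sum_image]
    · apply Finset.sum_congr rfl
      rintro ⟨a, b⟩ _
      push_cast
      rw [one_div_mul_one_div]
    · rintro ⟨a, b⟩ hab ⟨c, d⟩ hcd hh
      simp only [Finset.coe_product, Set.mem_prod, Finset.coe_filter, Set.mem_ofPred_eq, Finset.mem_Ioc] at hab
      simp only [Sigma.mk.injEq, heq_eq_eq] at hh
      obtain ⟨h1, rfl⟩ := hh
      simp only [Prod.mk.injEq, true_and]
      exact Nat.eq_of_mul_eq_mul_left hab.1.1.1 h1
  rw [h3]
  apply Finset.sum_le_sum_of_subset_of_nonneg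
  · intro x hx
    simp only [Finset.mem_image, Finset.mem_product, Finset.mem_filter, Finset.mem_Ioc] at hx
    obtain ⟨⟨e, m⟩, ⟨⟨⟨h1, h2⟩, h3⟩, h4, h5⟩, rfl⟩ := hx
    simp only [Finset.mem_sigma, Finset.mem_Ioc, Finset.mem_filter, Nat.mem_divisors] at *
    have : 0 < e * m := Nat.mul_pos h1 h4
    exact ⟨⟨this, (Nat.mul_le_mul h2 h5).trans hyz⟩, ⟨Dvd.intro _ rfl, this.ne'⟩, h3⟩
  · intros; positivity

lemma er_coprime_sum (s : Finset ℕ) (hs : ∀ p ∈ s, p.Prime) (y : ℕ) :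
    (∏ p ∈ s, (1 - (1:ℝ) / p)) * ∑ m ∈ Finset.Ioc 0 y, (1:ℝ) / m
      ≤ ∑ e ∈ (Finset.Ioc 0 y).filter (fun e => ∀ p ∈ s, ¬ p ∣ e), (1:ℝ) / e := by
  induction s using Finset.induction_on with
  | empty => simp
  | insert p s hps ih =>
    have ih := ih (fun q hq => hs q (Finset.mem_insert_of_mem hq))
    have hp := hs p (Finset.mem_insert_self p s)
    have hp0 : (0:ℝ) < p := by exact_mod_cast hp.pos
    have hp1 : (1:ℝ) / p ≤ 1 := by
      rw [div_le_one hp0]; exact_mod_cast hp.one_lt.le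
    rw [Finset.prod_insert hps, mul_assoc]
    refine (mul_le_mul_of_nonneg_left ih (by linarith)).trans ?_
    set A := (Finset.Ioc 0 y).filter (fun e => ∀ p ∈ s, ¬ p ∣ e) with hA
    have h1 : ∑ e ∈ A, (1:ℝ) / e = ∑ e ∈ A with p ∣ e, (1:ℝ)/e + ∑ e ∈ A with ¬ p ∣ e, (1:ℝ)/e :=
      (Finset.sum_filter_add_sum_filter_not A (fun e => p ∣ e) _).symm
    have h2 : A.filter (fun e => ¬ p ∣ e) = (Finset.Ioc 0 y).filter (fun e => ∀ q ∈ insert p s, ¬ q ∣ e) := by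
      ext e
      simp only [hA, Finset.mem_filter, Finset.forall_mem_insert]
      tauto
    have h3 : ∑ e ∈ A with p ∣ e, (1:ℝ)/e ≤ (1/p) * ∑ e ∈ A, (1:ℝ)/e := by
      rw [Finset.mul_sum]
      have : ∑ e ∈ A with p ∣ e, (1:ℝ)/e = ∑ e ∈ (A.filter (fun e => p ∣ e)).image (fun e => e / p), 1/(p:ℝ) * (1/e) := by
        rw [Finset.sum_image]
        · apply Finset.sum_congr rfl
          intro e he
          obtain ⟨k, rfl⟩ := (Finset.mem_filter.mp he).2
          rw [Nat.mul_div_cancel_left _ hp.pos]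
          push_cast; rw [one_div_mul_one_div]
        · intro a ha b hb hab
          simp only [Finset.coe_filter, Set.mem_ofPred_eq] at ha hb
          simp only at hab
          rw [← Nat.mul_div_cancel' ha.2, ← Nat.mul_div_cancel' hb.2, hab]
      rw [this]
      apply Finset.sum_le_sum_of_subset_of_nonneg
      · intro k hk
        simp only [Finset.mem_image, Finset.mem_filter, hA, Finset.mem_Ioc] at hk ⊢
        obtain ⟨e, ⟨⟨⟨h1, h2⟩, h3⟩, ⟨k, rfl⟩⟩, rfl⟩ := hk
        rw [Nat.mul_div_cancel_left _ hp.pos]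
        refine ⟨⟨Nat.pos_of_mul_pos_left h1, ?_⟩, fun q hq hqk => h3 q hq (hqk.mul_left p)⟩
        exact (Nat.le_mul_of_pos_left k hp.pos).trans h2
      · intros; positivity
    rw [← h2]
    linarith

noncomputable def erG (h : ℕ) : ℝ := ∏ p ∈ h.primeFactors, (1 - (1:ℝ) / p)

lemma erG_pos (h : ℕ) : 0 < erG h := by
  apply Finset.prod_pos
  intro p hp
  have := (Nat.prime_of_mem_primeFactors hp).one_lt
  have h1 : (1:ℝ) < p := by exact_mod_cast this
  have : (1:ℝ)/p < 1 := by rw [div_lt_one (by linarith)]; exact h1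
  linarith

lemma er_S_final (h N y : ℕ) (hh : Even h) (h0 : h ≠ 0) :
    erG h * Real.log (y + 1) ^ 2 ≤ erS (erSieve h N (y*y) hh) (y*y) := by
  refine le_trans ?_ (er_S_ge h N (y*y) hh)
  refine le_trans ?_ (er_prod_ge h y (y*y) le_rfl)
  have h1 := er_coprime_sum h.primeFactors (fun p hp => Nat.prime_of_mem_primeFactors hp) y
  have h2 : (Finset.Ioc 0 y).filter (fun e => ∀ p ∈ h.primeFactors, ¬ p ∣ e) ⊆ (Finset.Ioc 0 y).filter (fun e => e.Coprime h) := by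
    intro e he
    rw [Finset.mem_filter] at he ⊢
    refine ⟨he.1, Nat.coprime_of_dvd ?_⟩
    intro p hp hpe hph
    exact he.2 p (by simp [hp, hph, h0]) hpe
  have h3 := h1.trans (Finset.sum_le_sum_of_subset_of_nonneg h2 (f := fun e : ℕ => (1:ℝ)/e) (by intros; positivity))
  have h4 := er_harm' y
  have h5 := erG_pos h
  have h6 : 0 ≤ Real.log ((y:ℝ)+1) := Real.log_nonneg (by have : (0:ℝ) ≤ y := by positivity
                                                          linarith)
  change erG h * _ ≤ _ at h3
  calc erG h * Real.log (y + 1) ^ 2 = (erG h * Real.log (y+1)) * Real.log (y+1) := by ring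
    _ ≤ (erG h * ∑ m ∈ Finset.Ioc 0 y, (1:ℝ) / m) * ∑ m ∈ Finset.Ioc 0 y, (1:ℝ) / m := by gcongr
    _ ≤ _ := by
      apply mul_le_mul_of_nonneg_right h3 (h6.trans h4)

theorem er_prod_sq (s : Finset ℕ) (hs : ∀ p ∈ s, 2 ≤ p) :
    (1:ℝ)/2 ≤ ∏ p ∈ s, (1 - (1:ℝ)/p^2) := by
  have key : ∀ M : ℕ, ∏ p ∈ Finset.Ico 2 (M+2), (1 - (1:ℝ)/p^2) = ((M:ℝ)+2)/(2*(M+1)) := by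
    intro M
    induction M with
    | zero => norm_num
    | succ k ih =>
      rw [show k + 1 + 2 = (k+2)+1 by ring, Finset.prod_Ico_succ_top (by omega), ih]
      push_cast
      field_simp
      ring
  have hsub : s ⊆ Finset.Ico 2 (s.sup id + 2) := by
    intro p hp
    have : p ≤ s.sup id := Finset.le_sup (f := id) hp
    simp only [Finset.mem_Ico]
    exact ⟨hs p hp, by omega⟩
  have hnn : ∀ p : ℕ, 2 ≤ p → (0:ℝ) ≤ 1 - 1/(p:ℝ)^2 ∧ 1 - 1/(p:ℝ)^2 ≤ 1 := by
    intro p hp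
    have h2 : (2:ℝ) ≤ p := by exact_mod_cast hp
    have : 1/(p:ℝ)^2 ≤ 1 := by
      rw [div_le_one (by positivity)]; nlinarith
    have h0 : 0 ≤ 1/(p:ℝ)^2 := by positivity
    constructor <;> linarith
  have h1 := Finset.prod_sdiff (f := fun p : ℕ => (1 - (1:ℝ)/(p:ℝ)^2)) hsub
  rw [key] at h1
  have h2 : ∏ p ∈ (Finset.Ico 2 (s.sup id + 2)) \ s, (1 - (1:ℝ)/(p:ℝ)^2) ≤ 1 := by
    apply Finset.prod_le_one
    · intro p hp
      exact (hnn p (Finset.mem_Ico.1 (Finset.mem_sdiff.1 hp).1).1).1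
    · intro p hp
      exact (hnn p (Finset.mem_Ico.1 (Finset.mem_sdiff.1 hp).1).1).2
  have h3 : 0 ≤ ∏ p ∈ s, (1 - (1:ℝ)/(p:ℝ)^2) :=
    Finset.prod_nonneg fun p hp => (hnn p (hs p hp)).1
  have h4 : (1:ℝ)/2 ≤ (((s.sup id : ℕ):ℝ)+2)/(2*((s.sup id : ℕ)+1)) := by
    rw [div_le_div_iff₀ (by norm_num) (by positivity)]
    linarith
  rw [← h1] at h4
  nlinarith

theorem er_prod_add (h : ℕ) (h0 : h ≠ 0) :
    ∏ p ∈ h.primeFactors, (1 + (1:ℝ)/p) ≤ ∑ d ∈ h.divisors, (1:ℝ)/d := by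
  rw [Finset.prod_one_add]
  have hinj : Set.InjOn (fun t : Finset ℕ => ∏ p ∈ t, p) (h.primeFactors.powerset : Set (Finset ℕ)) := by
    intro t ht u hu htu
    have ht' := Finset.mem_powerset.1 (Finset.mem_coe.1 ht)
    have hu' := Finset.mem_powerset.1 (Finset.mem_coe.1 hu)
    have e1 := Nat.primeFactors_prod (s := t) fun p hp => Nat.prime_of_mem_primeFactors (ht' hp)
    have e2 := Nat.primeFactors_prod (s := u) fun p hp => Nat.prime_of_mem_primeFactors (hu' hp)
    rw [← e1, ← e2]
    exact congrArg _ htu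
  have : ∑ t ∈ h.primeFactors.powerset, ∏ p ∈ t, (1:ℝ)/p
      = ∑ d ∈ h.primeFactors.powerset.image (fun t : Finset ℕ => ∏ p ∈ t, p), (1:ℝ)/d := by
    rw [Finset.sum_image hinj]
    apply Finset.sum_congr rfl
    intro t _
    push_cast
    simp
  rw [this]
  apply Finset.sum_le_sum_of_subset_of_nonneg
  · intro d hd
    obtain ⟨t, ht, rfl⟩ := Finset.mem_image.1 hd
    rw [Nat.mem_divisors]
    refine ⟨?_, h0⟩
    exact (Finset.prod_dvd_prod_of_subset _ _ _ (Finset.mem_powerset.1 ht)).trans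
      (Nat.prod_primeFactors_dvd h)
  · intros; positivity

theorem er_G_inv (h : ℕ) (h0 : h ≠ 0) :
    (erG h)⁻¹ ≤ 2 * ∑ d ∈ h.divisors, (1:ℝ)/d := by
  have h1 := er_prod_add h h0
  have h2 := er_prod_sq h.primeFactors fun p hp => (Nat.prime_of_mem_primeFactors hp).two_le
  have h3 : ∏ p ∈ h.primeFactors, (1 - (1:ℝ)/p^2)
      = erG h * ∏ p ∈ h.primeFactors, (1 + (1:ℝ)/p) := by
    rw [erG, ← Finset.prod_mul_distrib]
    apply Finset.prod_congr rfl
    intro p _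
    ring
  have h4 := erG_pos h
  rw [h3] at h2
  rw [inv_le_iff_one_le_mul₀ h4]
  nlinarith

theorem er_card_mult (a b d : ℕ) (hab : a ≤ b) (hd : 0 < d) :
    (((Finset.Ioc a b).filter (fun h => d ∣ h)).card : ℝ) ≤ ((b:ℝ) - a)/d + 1 := by
  have h1 := Nat.Ioc_filter_dvd_card_eq_div b d
  have h2 := Nat.Ioc_filter_dvd_card_eq_div a d
  have h3 : ((Finset.Ioc 0 b).filter (fun h => d ∣ h))
      = ((Finset.Ioc 0 a).filter (fun h => d ∣ h)) ∪ ((Finset.Ioc a b).filter (fun h => d ∣ h)) := by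
    rw [← Finset.filter_union, Finset.Ioc_union_Ioc_eq_Ioc (Nat.zero_le a) hab]
  have h4 : Disjoint ((Finset.Ioc 0 a).filter (fun h => d ∣ h)) ((Finset.Ioc a b).filter (fun h => d ∣ h)) := by
    rw [Finset.disjoint_left]
    intro x hx hy
    simp only [Finset.mem_filter, Finset.mem_Ioc] at hx hy
    omega
  rw [h3, Finset.card_union_of_disjoint h4, h2] at h1
  have h5 : ((a/d : ℕ):ℝ) + (((Finset.Ioc a b).filter (fun h => d ∣ h)).card : ℝ) = ((b/d : ℕ):ℝ) := by
    exact_mod_cast h1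
  have h6 : ((b/d : ℕ):ℝ) ≤ (b:ℝ)/d := Nat.cast_div_le
  have h7 : (a:ℝ)/d ≤ ((a/d : ℕ):ℝ) + 1 := by
    rw [div_le_iff₀ (by positivity)]
    have := Nat.lt_div_mul_add (a := a) hd
    have h8 : a ≤ (a/d+1)*d := by nlinarith
    exact_mod_cast h8
  rw [sub_div]
  linarith

theorem er_sum_sq (n : ℕ) : ∑ d ∈ Finset.Ioc 0 n, (1:ℝ)/(d:ℝ)^2 ≤ 2 - 1/(n:ℝ) := by
  induction n with
  | zero => norm_num
  | succ k ih =>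
    rw [← Finset.insert_Ioc_right_eq_Ioc_add_one (Nat.zero_le k), Finset.sum_insert (by simp)]
    rcases Nat.eq_zero_or_pos k with hk | hk
    · subst hk; norm_num
    have hk' : (0:ℝ) < k := by exact_mod_cast hk
    have : (1:ℝ)/((k+1:ℕ):ℝ)^2 ≤ 1/(k:ℝ) - 1/((k+1:ℕ):ℝ) := by
      push_cast
      rw [div_sub_div _ _ (by positivity) (by positivity), div_le_div_iff₀ (by positivity) (by positivity)]
      nlinarith
    linarith

theorem er_G_avg (a b : ℕ) (hab : a ≤ b) :
    ∑ h ∈ Finset.Ioc a b, (erG h)⁻¹ ≤ 2 * (2 * ((b:ℝ) - a) + 1 + Real.log b) := by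
  have h1 : ∑ h ∈ Finset.Ioc a b, (erG h)⁻¹ ≤ ∑ h ∈ Finset.Ioc a b,
      2 * ∑ d ∈ (Finset.Ioc 0 b).filter (fun d => d ∣ h), (1:ℝ)/d := by
    apply Finset.sum_le_sum
    intro h hh
    rw [Finset.mem_Ioc] at hh
    refine (er_G_inv h (by omega)).trans ?_
    gcongr
    intro d hd
    rw [Nat.mem_divisors] at hd
    rw [Finset.mem_filter, Finset.mem_Ioc]
    have := Nat.pos_of_dvd_of_pos hd.1 (by omega)
    have := Nat.le_of_dvd (by omega) hd.1
    exact ⟨⟨by omega, by omega⟩, hd.1⟩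
  refine h1.trans ?_
  rw [← Finset.mul_sum]
  apply mul_le_mul_of_nonneg_left _ (by norm_num)
  simp only [Finset.sum_filter]
  rw [Finset.sum_comm]
  have hb : (0:ℝ) ≤ (b:ℝ) - a := by
    have : (a:ℝ) ≤ b := by exact_mod_cast hab
    linarith
  have h2 : ∀ d ∈ Finset.Ioc 0 b, ∑ h ∈ Finset.Ioc a b, (if d ∣ h then (1:ℝ)/d else 0)
      ≤ ((b:ℝ)-a) * (1/(d:ℝ)^2) + 1/d := by
    intro d hd
    rw [Finset.mem_Ioc] at hd
    rw [← Finset.sum_filter, Finset.sum_const, nsmul_eq_mul]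
    have := er_card_mult a b d hab hd.1
    have hd' : (0:ℝ) < d := by exact_mod_cast hd.1
    calc _ ≤ (((b:ℝ) - a)/d + 1) * (1/d) := by gcongr
      _ = _ := by field_simp
  refine (Finset.sum_le_sum h2).trans ?_
  rw [Finset.sum_add_distrib, ← Finset.mul_sum]
  have h3 := er_harm b
  have h4 : ∑ d ∈ Finset.Ioc 0 b, (1:ℝ)/(d:ℝ)^2 ≤ 2 := by
    have := er_sum_sq b
    have h0 : (0:ℝ) ≤ 1/(b:ℝ) := by positivity
    linarith
  nlinarith

theorem er_pair_bound (h X : ℕ) (hh : Even h) (h0 : h ≠ 0) (hX : 2 ≤ X) :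
    (((Finset.Ico 1 (1 + X)).filter (fun n => n.Prime ∧ (n + h).Prime)).card : ℝ)
      ≤ 1024 * (X / Real.log X ^ 2) * (erG h)⁻¹ + 2 * (X:ℝ) ^ ((1:ℝ)/2) := by
  have hX1 : (1:ℝ) < X := by exact_mod_cast (by omega : 1 < X)
  have hX0 : (0:ℝ) < X := by linarith
  have hL : 0 < Real.log X := Real.log_pos hX1
  obtain ⟨y, hy⟩ : ∃ y : ℕ, y = ⌊(X:ℝ) ^ ((1:ℝ)/32)⌋₊ := ⟨_, rfl⟩
  have hx1 : (1:ℝ) ≤ (X:ℝ) ^ ((1:ℝ)/32) := Real.one_le_rpow hX1.le (by norm_num)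
  have hy1 : 1 ≤ y := by
    rw [hy]; exact Nat.le_floor (by simpa using hx1)
  have hyle : (y:ℝ) ≤ (X:ℝ) ^ ((1:ℝ)/32) := by
    rw [hy]; exact Nat.floor_le (by positivity)
  have hylt : (X:ℝ) ^ ((1:ℝ)/32) ≤ (y:ℝ) + 1 := by
    rw [hy]; exact (Nat.lt_floor_add_one _).le
  have hy16 : (y:ℝ)^16 ≤ (X:ℝ) ^ ((1:ℝ)/2) := by
    calc (y:ℝ)^16 ≤ ((X:ℝ) ^ ((1:ℝ)/32))^16 := by gcongr
      _ = (X:ℝ) ^ ((1:ℝ)/2) := by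
        rw [← Real.rpow_natCast, ← Real.rpow_mul hX0.le]; norm_num
  have hlog : Real.log X / 32 ≤ Real.log (y+1) := by
    have := Real.log_le_log (by positivity) hylt
    rw [Real.log_rpow hX0] at this
    linarith
  have h1 := er_pairs h X (y*y) hh (by nlinarith)
  have h2 := er_S_final h X y hh h0
  have hG := erG_pos h
  have hy1' : (1:ℝ) ≤ y := by exact_mod_cast hy1
  have h3 : erG h * (Real.log X ^ 2 / 1024) ≤ erG h * Real.log (y+1)^2 := by
    gcongr
    nlinarith
  have h4 := h3.trans h2
  have h5 := div_le_div_of_nonneg_left hX0.le (by positivity) h4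
  have h6 : (((y*y : ℕ)):ℝ) ≤ (y:ℝ)^16 := by
    push_cast
    calc (y:ℝ)*y = y^2 := by ring
      _ ≤ y^16 := pow_le_pow_right₀ hy1' (by norm_num)
  have h7 : (((y*y : ℕ)):ℝ)^8 = (y:ℝ)^16 := by push_cast; ring
  have h8 : (X:ℝ) / (erG h * (Real.log X ^ 2 / 1024)) = 1024 * (X / Real.log X ^ 2) * (erG h)⁻¹ := by
    field_simp
  rw [h8] at h5
  linarith

theorem er_log_sq : ∀ ε : ℝ, 0 < ε → ∀ᶠ X : ℕ in atTop,
    Real.log X ^ 2 * (X:ℝ) ^ ((1:ℝ)/2) ≤ ε * X := by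
  intro ε hε
  have h := (isLittleO_log_rpow_rpow_atTop 2 (by norm_num : (0:ℝ) < 1/2)).bound hε
  have h' := tendsto_natCast_atTop_atTop.eventually h
  filter_upwards [h', eventually_ge_atTop 2] with X hX hX2
  have hX1 : (1:ℝ) < X := by exact_mod_cast (by omega : 1 < X)
  have hL : 0 < Real.log X := Real.log_pos hX1
  rw [Real.norm_of_nonneg (by positivity), Real.norm_of_nonneg (by positivity)] at hX
  have e : (X:ℝ) = (X:ℝ) ^ ((1:ℝ)/2) * (X:ℝ) ^ ((1:ℝ)/2) := by
    rw [← Real.rpow_add (by linarith)]; norm_num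
  have e2 : Real.log X ^ (2:ℝ) = Real.log X ^ 2 := by exact_mod_cast Real.rpow_natCast _ 2
  rw [e2] at hX
  have hp : 0 ≤ (X:ℝ) ^ ((1:ℝ)/2) := by positivity
  calc Real.log X ^ 2 * (X:ℝ) ^ ((1:ℝ)/2) ≤ (ε * (X:ℝ) ^ ((1:ℝ)/2)) * (X:ℝ) ^ ((1:ℝ)/2) := by gcongr
    _ = ε * ((X:ℝ) ^ ((1:ℝ)/2) * (X:ℝ) ^ ((1:ℝ)/2)) := by ring
    _ = ε * X := by rw [← e]

theorem er_log_pow (η : ℝ) (hη : 0 < η) : ∀ ε : ℝ, 0 < ε → ∀ᶠ X : ℕ in atTop,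
    Real.log X * (X:ℝ) ^ (1 - η) ≤ ε * X := by
  intro ε hε
  have h := (isLittleO_log_rpow_atTop hη).bound hε
  have h' := tendsto_natCast_atTop_atTop.eventually h
  filter_upwards [h', eventually_ge_atTop 2] with X hX hX2
  have hX1 : (1:ℝ) < X := by exact_mod_cast (by omega : 1 < X)
  have hL : 0 < Real.log X := Real.log_pos hX1
  rw [Real.norm_of_nonneg (by positivity), Real.norm_of_nonneg (by positivity)] at hX
  have e : (X:ℝ) = (X:ℝ) ^ η * (X:ℝ) ^ (1-η) := by
    rw [← Real.rpow_add (by linarith)]; norm_num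
  have hp : 0 ≤ (X:ℝ) ^ (1-η) := by positivity
  calc Real.log X * (X:ℝ) ^ (1-η) ≤ (ε * (X:ℝ) ^ η) * (X:ℝ) ^ (1-η) := by gcongr
    _ = ε * ((X:ℝ) ^ η * (X:ℝ) ^ (1-η)) := by ring
    _ = ε * X := by rw [← e]

theorem er_log_tendsto : Tendsto (fun X : ℕ => Real.log X) atTop atTop :=
  Real.tendsto_log_atTop.comp tendsto_natCast_atTop_atTop

theorem er_window (η : ℝ) (hη : 0 < η) (hη1 : η < 1/2) : ∀ᶠ X : ℕ in atTop,
    Real.log X * ∑ h ∈ (Finset.Ioc (⌈(1 - 2*η) * Real.log X⌉₊ - 1) ⌊(1 + η) * Real.log X⌋₊).filter (fun h => Even h),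
      (((Finset.Ico 1 (1 + X)).filter (fun n => n.Prime ∧ (n + h).Prime)).card : ℝ)
      ≤ 20000 * η * X := by
  have hlo : ∀ᶠ X : ℕ in atTop, 6 + 2 * Real.log (2 * Real.log X) ≤ η * Real.log X := by
    have h := Real.isLittleO_log_id_atTop.bound (show 0 < η / 8 by positivity)
    have h2 := (er_log_tendsto.const_mul_atTop (show (0:ℝ) < 2 by norm_num)).eventually h
    filter_upwards [h2, er_log_tendsto.eventually_ge_atTop (1 + 12/η)] with X hX hX2
    have hq : 0 < 12/η := by positivity
    simp only [id] at hX
    rw [Real.norm_of_nonneg (show 0 ≤ 2 * Real.log X by linarith)] at hX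
    have := (le_abs_self _).trans hX
    have h12 : 12 ≤ η * Real.log X := by
      have : η * (12/η) ≤ η * Real.log X := by gcongr; linarith
      rwa [mul_div_cancel₀ _ hη.ne'] at this
    linarith
  filter_upwards [hlo, er_log_sq (η) (by positivity), eventually_ge_atTop 2,
    er_log_tendsto.eventually_ge_atTop 1, er_log_tendsto.eventually_ge_atTop (1/η)] with X h1 h2 hX2 hL1 hLη
  have hX1 : (1:ℝ) < X := by exact_mod_cast (by omega : 1 < X)
  set L := Real.log X with hLdef
  set a := ⌈(1 - 2*η) * L⌉₊ - 1 with ha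
  set b := ⌊(1 + η) * L⌋₊ with hb
  have hηL : 1 ≤ η * L := by
    rw [div_le_iff₀ hη] at hLη; linarith
  have hc : (⌈(1 - 2*η) * L⌉₊:ℝ) < (1-2*η)*L + 1 := Nat.ceil_lt_add_one (by nlinarith)
  have hc1 : 0 < ⌈(1 - 2*η) * L⌉₊ := Nat.ceil_pos.2 (by nlinarith)
  have hc2 : (1-2*η)*L ≤ (⌈(1 - 2*η) * L⌉₊:ℝ) := Nat.le_ceil _
  have haR : (a:ℝ) = (⌈(1 - 2*η) * L⌉₊:ℝ) - 1 := by
    rw [ha, Nat.cast_sub (by omega)]; simp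
  have hbR : (b:ℝ) ≤ (1+η)*L := Nat.floor_le (by positivity)
  have hbR2 : (1+η)*L < (b:ℝ) + 1 := Nat.lt_floor_add_one _
  have hab : a ≤ b := by
    have : (a:ℝ) ≤ b := by nlinarith
    exact_mod_cast this
  have hav := er_G_avg a b hab
  have hb2 : (b:ℝ) ≤ 2 * L := by nlinarith
  have hb0 : (0:ℝ) < b := by nlinarith
  have hlogb : Real.log b ≤ Real.log (2 * L) := Real.log_le_log hb0 hb2
  have hsum : ∑ h ∈ (Finset.Ioc a b).filter (fun h => Even h),
      (((Finset.Ico 1 (1 + X)).filter (fun n => n.Prime ∧ (n + h).Prime)).card : ℝ)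
      ≤ ∑ h ∈ Finset.Ioc a b, (1024 * (X / L ^ 2) * (erG h)⁻¹ + 2 * (X:ℝ) ^ ((1:ℝ)/2)) := by
    refine (Finset.sum_le_sum (g := fun h => (1024 * (X / L ^ 2) * (erG h)⁻¹ + 2 * (X:ℝ) ^ ((1:ℝ)/2))) ?_).trans ?_
    · intro h hh
      rw [Finset.mem_filter, Finset.mem_Ioc] at hh
      exact er_pair_bound h X hh.2 (by omega) hX2
    · apply Finset.sum_le_sum_of_subset_of_nonneg (Finset.filter_subset _ _)
      intro h _ _
      have := erG_pos h
      positivity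
  rw [Finset.sum_add_distrib, ← Finset.mul_sum, Finset.sum_const, nsmul_eq_mul, Nat.card_Ioc] at hsum
  have hba : (((b - a : ℕ)):ℝ) ≤ 2 * L := by
    refine le_trans ?_ hb2
    exact_mod_cast Nat.sub_le b a
  have hL0 : 0 < L := by linarith
  have hXh : 0 ≤ (X:ℝ) ^ ((1:ℝ)/2) := by positivity
  have hA : ∑ h ∈ Finset.Ioc a b, (erG h)⁻¹ ≤ 13 * η * L := by nlinarith
  calc L * _ ≤ L * (1024 * (X / L ^ 2) * (13 * η * L) + (2*L) * (2 * (X:ℝ) ^ ((1:ℝ)/2))) := by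
        refine mul_le_mul_of_nonneg_left (hsum.trans ?_) hL0.le
        gcongr
    _ = 13312 * η * X + 4 * (L^2 * (X:ℝ) ^ ((1:ℝ)/2)) := by field_simp; ring
    _ ≤ 13312 * η * X + 4 * (η * X) := by gcongr
    _ ≤ 20000 * η * X := by nlinarith [mul_pos hη (show (0:ℝ) < X by linarith)]

noncomputable def erq (n : ℕ) : ℕ := Nat.nth Nat.Prime n

theorem erq_prime (n : ℕ) : (erq n).Prime := Nat.prime_nth_prime n

theorem erq_mono : StrictMono erq := Nat.nth_strictMono Nat.infinite_setOfPred_prime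

theorem er_theta_eq (x : ℕ) :
    Chebyshev.theta x = ∑ n ∈ Finset.range (Nat.count Nat.Prime (x+1)), Real.log (erq n) := by
  rw [Chebyshev.theta, Nat.floor_natCast]
  have : (Finset.Ioc 0 x).filter Nat.Prime = (Finset.range (Nat.count Nat.Prime (x+1))).image erq := by
    ext p
    simp only [Finset.mem_filter, Finset.mem_Ioc, Finset.mem_image, Finset.mem_range]
    constructor
    · rintro ⟨⟨_, h2⟩, hp⟩
      exact ⟨Nat.count Nat.Prime p, Nat.count_strict_mono hp (by omega), Nat.nth_count hp⟩
    · rintro ⟨n, hn, rfl⟩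
      have h1 : erq n < x + 1 := Nat.nth_lt_of_lt_count hn
      exact ⟨⟨(erq_prime n).pos, by omega⟩, erq_prime n⟩
  rw [this, Finset.sum_image (erq_mono.injective.injOn)]

theorem er_theta_q (N : ℕ) :
    Chebyshev.theta (erq N) = ∑ n ∈ Finset.range (N+1), Real.log (erq n) := by
  rw [er_theta_eq]
  congr 2
  exact Nat.count_nth_succ_of_infinite Nat.infinite_setOfPred_prime N

theorem erq_log_pos (n : ℕ) : 0 < Real.log (erq n) :=
  Real.log_pos (by exact_mod_cast (erq_prime n).one_lt)

theorem er_no_theta_q (δ : ℝ) (hδ : 0 < δ) (hδ1 : δ < 1)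
    (H : ∀ᶠ N in atTop, Chebyshev.theta (erq N) ≤ (1 - δ) * erq N) : False := by
  obtain ⟨N1, hN1⟩ := eventually_atTop.1 H
  refine er_no_theta δ (∑ n ∈ Finset.range (N1+1), Real.log (erq n)) hδ hδ1 ?_
  intro x
  have hC : 0 ≤ ∑ n ∈ Finset.range (N1+1), Real.log (erq n) :=
    Finset.sum_nonneg fun n _ => (erq_log_pos n).le
  have hx0 : 0 ≤ (1 - δ) * (x:ℝ) := mul_nonneg (by linarith) (by positivity)
  by_cases hk : Nat.count Nat.Prime (x+1) ≤ N1 + 1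
  · rw [er_theta_eq]
    have : ∑ n ∈ Finset.range (Nat.count Nat.Prime (x+1)), Real.log (erq n)
        ≤ ∑ n ∈ Finset.range (N1+1), Real.log (erq n) :=
      Finset.sum_le_sum_of_subset_of_nonneg (Finset.range_subset_range.2 hk)
        fun n _ _ => (erq_log_pos n).le
    linarith
  · obtain ⟨N, hN⟩ : ∃ N, Nat.count Nat.Prime (x+1) = N + 1 := ⟨_, (Nat.sub_add_cancel (by omega)).symm⟩
    have h1 := hN1 N (by omega)
    rw [er_theta_q] at h1
    rw [er_theta_eq, hN]
    have h2 : erq N < x + 1 := Nat.nth_lt_of_lt_count (by omega)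
    have h3 : (erq N : ℝ) ≤ x := by exact_mod_cast (by omega : erq N ≤ x)
    have h4 : (1-δ) * (erq N:ℝ) ≤ (1-δ) * x := mul_le_mul_of_nonneg_left h3 (by linarith)
    linarith

theorem er_B (η : ℝ) (hη : 0 < η) (hη1 : η < 1/2) (n0 N : ℕ) (hn0 : 1 ≤ n0)
    (H : ∀ n ≥ n0, (1 - η) * Real.log (erq n) ≤ (erq (n+1) : ℝ) - erq n) :
    (((Finset.Ico n0 N).filter
      (fun n => (erq (n+1) : ℝ) - erq n < (1 + η) * Real.log (erq n))).card : ℝ)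
    ≤ ((erq N : ℝ) ^ (1 - η) + 1) +
      ∑ h ∈ (Finset.Ioc (⌈(1 - 2*η) * Real.log (erq N)⌉₊ - 1)
        ⌊(1 + η) * Real.log (erq N)⌋₊).filter (fun h => Even h),
      (((Finset.Ico 1 (1 + erq N)).filter (fun n => n.Prime ∧ (n + h).Prime)).card : ℝ) := by
  classical
  set L := Real.log (erq N) with hLdef
  have hL : 0 < L := erq_log_pos N
  have hX1 : (1:ℝ) < erq N := by exact_mod_cast (erq_prime N).one_lt
  set W := (Finset.Ioc (⌈(1 - 2*η) * L⌉₊ - 1) ⌊(1 + η) * L⌋₊).filter (fun h => Even h) with hW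
  set P := fun h : ℕ => (Finset.Ico 1 (1 + erq N)).filter (fun n => n.Prime ∧ (n + h).Prime) with hP
  set B := (Finset.Ico n0 N).filter
      (fun n => (erq (n+1) : ℝ) - erq n < (1 + η) * Real.log (erq n)) with hB
  set R := Finset.range (⌊(erq N : ℝ) ^ (1 - η)⌋₊ + 1) with hR
  have hmap : (B \ R).image erq ⊆ W.biUnion P := by
    intro p hp
    obtain ⟨n, hn, rfl⟩ := Finset.mem_image.1 hp
    rw [Finset.mem_sdiff, hB, Finset.mem_filter, Finset.mem_Ico, hR, Finset.mem_range] at hn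
    obtain ⟨⟨⟨hn1, hn2⟩, hn3⟩, hn4⟩ := hn
    have hlt : erq n < erq (n+1) := erq_mono (by omega)
    have hltN : erq n < erq N := erq_mono hn2
    have hnq : n ≤ erq n := erq_mono.le_apply
    have h3 : 2 < erq n := by
      have := erq_mono (show 0 < n by omega)
      have := (erq_prime 0).two_le
      omega
    have hbig : (erq N : ℝ) ^ (1 - η) < erq n := by
      have h1 := Nat.lt_floor_add_one ((erq N : ℝ) ^ (1 - η))
      have h2 : ((⌊(erq N : ℝ) ^ (1 - η)⌋₊:ℝ)) + 1 ≤ erq n := by exact_mod_cast (by omega)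
      linarith
    have hlog1 : (1 - η) * L ≤ Real.log (erq n) := by
      have := Real.log_le_log (by positivity) hbig.le
      rwa [Real.log_rpow (by linarith)] at this
    have hlog2 : Real.log (erq n) ≤ L :=
      Real.log_le_log (by positivity) (by exact_mod_cast hltN.le)
    have hgap : ((erq (n+1) - erq n : ℕ):ℝ) = (erq (n+1) : ℝ) - erq n := by
      rw [Nat.cast_sub hlt.le]
    have hH := H n hn1
    rw [← hgap] at hH hn3
    rw [Finset.mem_biUnion]
    refine ⟨erq (n+1) - erq n, ?_, ?_⟩
    · rw [hW, Finset.mem_filter, Finset.mem_Ioc]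
      refine ⟨⟨?_, ?_⟩, ?_⟩
      · have h5 : ⌈(1 - 2*η) * L⌉₊ ≤ erq (n+1) - erq n := by
          rw [Nat.ceil_le]
          have : (1 - η) * ((1-η)*L) ≤ (1-η) * Real.log (erq n) :=
            mul_le_mul_of_nonneg_left hlog1 (by linarith)
          nlinarith [mul_pos (mul_pos hη hη) hL]
        omega
      · apply Nat.le_floor
        have : (1 + η) * Real.log (erq n) ≤ (1+η) * L :=
            mul_le_mul_of_nonneg_left hlog2 (by linarith)
        linarith
      · exact Nat.Odd.sub_odd ((erq_prime (n+1)).odd_of_ne_two (by omega))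
          ((erq_prime n).odd_of_ne_two (by omega))
    · rw [hP]
      simp only [Finset.mem_filter, Finset.mem_Ico]
      refine ⟨⟨by omega, by omega⟩, erq_prime n, ?_⟩
      rw [Nat.add_sub_cancel' hlt.le]
      exact erq_prime _
  have h1 : (B \ R).card ≤ ∑ h ∈ W, (P h).card := by
    rw [← Finset.card_image_of_injective _ erq_mono.injective]
    exact (Finset.card_le_card hmap).trans Finset.card_biUnion_le
  have h2 : B.card ≤ R.card + ∑ h ∈ W, (P h).card := by
    have := Finset.card_le_card_sdiff_add_card (s := B) (t := R)
    omega
  have h3 : (R.card : ℝ) ≤ (erq N : ℝ) ^ (1 - η) + 1 := by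
    rw [hR, Finset.card_range]
    push_cast
    have := Nat.floor_le (show 0 ≤ (erq N : ℝ) ^ (1 - η) by positivity)
    linarith
  have h4 : (B.card : ℝ) ≤ R.card + ∑ h ∈ W, ((P h).card : ℝ) := by exact_mod_cast h2
  linarith

theorem er_gap_sum (η : ℝ) (hη : 0 < η) (n0 N : ℕ) (hN : n0 ≤ N)
    (H : ∀ n ≥ n0, (1 - η) * Real.log (erq n) ≤ (erq (n+1) : ℝ) - erq n) :
    (1 + η) * ∑ n ∈ Finset.Ico n0 N, Real.log (erq n) ≤ erq N + 2 * η *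
      (Real.log (erq N) * (((Finset.Ico n0 N).filter
      (fun n => (erq (n+1) : ℝ) - erq n < (1 + η) * Real.log (erq n))).card : ℝ)) := by
  have h1 : ∑ n ∈ Finset.Ico n0 N, ((erq (n+1) : ℝ) - erq n) = erq N - erq n0 :=
    Finset.sum_Ico_sub (fun n => (erq n : ℝ)) hN
  have h2 : ∀ n ∈ Finset.Ico n0 N, (1 + η) * Real.log (erq n) ≤ ((erq (n+1) : ℝ) - erq n)
      + (if (erq (n+1) : ℝ) - erq n < (1 + η) * Real.log (erq n) then 2 * η * Real.log (erq N) else 0) := by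
    intro n hn
    rw [Finset.mem_Ico] at hn
    have hH := H n hn.1
    have hlog2 : Real.log (erq n) ≤ Real.log (erq N) :=
      Real.log_le_log (by exact_mod_cast (erq_prime n).pos) (by exact_mod_cast (erq_mono hn.2).le)
    split_ifs with hc
    · nlinarith
    · linarith
  have h3 := Finset.sum_le_sum h2
  rw [← Finset.mul_sum, Finset.sum_add_distrib, h1, ← Finset.sum_filter, Finset.sum_const, nsmul_eq_mul] at h3
  have : (0:ℝ) ≤ erq n0 := by positivity
  linarith

theorem er_combine (η : ℝ) (hη : η = 1/160000) (n0 : ℕ) (hn0 : 1 ≤ n0)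
    (H : ∀ n ≥ n0, (1 - η) * Real.log (erq n) ≤ (erq (n+1) : ℝ) - erq n) : False := by
  have hη0 : 0 < η := by rw [hη]; norm_num
  have hη1 : η < 1/2 := by rw [hη]; norm_num
  have hq : Tendsto erq atTop atTop := erq_mono.tendsto_atTop
  apply er_no_theta_q (1 - (1 + η/2)/(1+η))
  · rw [sub_pos, div_lt_one (by linarith)]; linarith
  · have : 0 < (1 + η/2)/(1+η) := by positivity
    linarith
  obtain ⟨C, hC⟩ : ∃ C : ℝ, C = ∑ n ∈ Finset.range n0, Real.log (erq n) := ⟨_, rfl⟩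
  filter_upwards [hq.eventually (er_window η hη0 hη1), hq.eventually (er_log_pow η hη0 (1/100) (by norm_num)),
    hq.eventually (er_log_pow (1/2) (by norm_num) (η/100) (by positivity)),
    eventually_ge_atTop n0,
    (tendsto_natCast_atTop_atTop.comp hq).eventually_ge_atTop (100 * C / η)] with N h1 h2 h3 hN h5
  have hB := er_B η hη0 hη1 n0 N hn0 H
  have hS := er_gap_sum η hη0 n0 N hN H
  have hX1 : (1:ℝ) < erq N := by exact_mod_cast (erq_prime N).one_lt
  have hL : 0 < Real.log (erq N) := erq_log_pos N
  have h3' : Real.log (erq N) ≤ η / 100 * erq N := by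
    refine le_trans ?_ h3
    have : (1:ℝ) ≤ (erq N:ℝ) ^ ((1:ℝ) - 1/2) := Real.one_le_rpow hX1.le (by norm_num)
    nlinarith
  have h5' : C ≤ η / 100 * erq N := by
    simp only [Function.comp] at h5
    rw [div_le_iff₀ hη0] at h5
    linarith
  have hθ : Chebyshev.theta (erq N) = C + ∑ n ∈ Finset.Ico n0 N, Real.log (erq n) + Real.log (erq N) := by
    rw [er_theta_q, Finset.sum_range_succ, hC, Finset.sum_range_add_sum_Ico _ hN]
  have hLB := mul_le_mul_of_nonneg_left hB hL.le
  rw [mul_add, mul_add] at hLB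
  have e : (1 - (1 - (1 + η/2)/(1+η))) * (erq N:ℝ) = ((1 + η/2) * erq N)/(1+η) := by ring
  rw [e, le_div_iff₀ (by linarith), hθ]
  set X : ℝ := (erq N : ℝ) with hX
  have hLB2 := hLB.trans (add_le_add (add_le_add h2 (by linarith : Real.log X * 1 ≤ η/100 * X)) h1)
  have hLB3 := mul_le_mul_of_nonneg_left hLB2 (show 0 ≤ 2 * η by linarith)
  have hfin := hS.trans (add_le_add le_rfl hLB3)
  have hC' : (1+η) * C ≤ 2 * (η/100*X) := by
    have : 0 ≤ C := by rw [hC]; exact Finset.sum_nonneg fun n _ => (erq_log_pos n).le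
    nlinarith
  have hL' : (1+η) * Real.log X ≤ 2 * (η/100*X) := by nlinarith
  have : (C + ∑ n ∈ Finset.Ico n0 N, Real.log (erq n) + Real.log X) * (1+η) ≤
     2 * (η/100*X) + 2 * (η/100*X) + (X + 2 * η * (1 / 100 * X + η / 100 * X + 20000 * η * X)) := by
    linarith
  refine this.trans ?_
  rw [hη]
  nlinarith

/-- (Erdős) `liminf (p_{n+1} - p_n)/log p_n < 1`. -/
theorem erdos_liminf_normalized_gap_lt_one :
    Filter.liminf
      (fun n : ℕ => ((nthPrime (n + 1) : ℝ) - nthPrime n) / Real.log (nthPrime n))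
      Filter.atTop < 1 := by
  obtain ⟨η, hη⟩ : ∃ η : ℝ, η = 1/160000 := ⟨_, rfl⟩
  by_contra hcon
  rw [not_lt] at hcon
  have hlt : 1 - η < Filter.liminf (fun n : ℕ => ((nthPrime (n + 1) : ℝ) - nthPrime n) / Real.log (nthPrime n)) Filter.atTop := by
    rw [hη]; linarith
  have hbdd : Filter.IsBoundedUnder (· ≥ ·) Filter.atTop
      (fun n : ℕ => ((nthPrime (n + 1) : ℝ) - nthPrime n) / Real.log (nthPrime n)) := by
    refine Filter.isBoundedUnder_of ⟨0, fun n => ?_⟩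
    have h1 : nthPrime n ≤ nthPrime (n+1) := erq_mono.monotone (by omega : n - 1 ≤ n + 1 - 1)
    have h2 : (nthPrime n : ℝ) ≤ nthPrime (n+1) := by exact_mod_cast h1
    have h3 : 0 < Real.log (nthPrime n) := erq_log_pos (n-1)
    exact div_nonneg (by linarith) h3.le
  have hev := Filter.eventually_lt_of_lt_liminf hlt hbdd
  obtain ⟨n1, hn1⟩ := eventually_atTop.1 hev
  refine er_combine η hη (n1 + 1) (by omega) ?_
  intro n hn
  have h := hn1 (n+1) (by omega)
  have e1 : nthPrime (n+1+1) = erq (n+1) := rfl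
  have e2 : nthPrime (n+1) = erq n := rfl
  rw [e1, e2, lt_div_iff₀ (erq_log_pos n)] at h
  exact h.le
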